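/- arXiv:1612.02025 — 2 statements merged into one kernel-verified Lean document; each statement's English description precedes it below -/
import Mathlib

section
/- Let (M,d) be a metric space and λ > 1. If there exists a good-λ-embedding from M into c₀, then M has property π(λ). -/
open Metric Set ZeroAtInfty

/-- The gap of a set `E ⊆ M × M`: `inf {d(x,y) : (x,y) ∈ E}`. -/
noncomputable def pairGap {M : Type*} [MetricSpace M] (E : Set (M × M)) : ℝ :=
  sInf ((fun p : M × M => dist p.1 p.2) '' E)

/-- The diameter of a set `E ⊆ M × M`: `sup {d(x,y) : (x,y) ∈ E}`. -/
noncomputable def pairDiam {M : Type*} [MetricSpace M] (E : Set (M × M)) : ℝ :=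
  sSup ((fun p : M × M => dist p.1 p.2) '' E)

/-- `π(E) = π₁(E) × π₂(E)`, the smallest rectangle containing `E`. -/
def pairRect {M : Type*} (E : Set (M × M)) : Set (M × M) :=
  (Prod.fst '' E) ×ˢ (Prod.snd '' E)

/-- `Es` is a finite partition of `E` into nonempty pairwise disjoint pieces. -/
def IsPartition {α : Type*} {N : ℕ} (Es : Fin N → Set α) (E : Set α) : Prop :=
  (∀ n, (Es n).Nonempty) ∧ (⋃ n, Es n) = E ∧
    ∀ i j : Fin N, i ≠ j → Disjoint (Es i) (Es j)

/-- Property `π(λ)`. -/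
def PropertyPi (M : Type*) [MetricSpace M] (lam : ℝ) : Prop :=
  ∀ (a₁ a₂ : M) (r₁ r₂ : ℝ) (E : Set (M × M)),
    E.Nonempty → E ⊆ (closedBall a₁ r₁) ×ˢ (closedBall a₂ r₂) →
    lam * (r₁ + r₂) < pairGap E →
    ∃ (N : ℕ) (Es : Fin N → Set (M × M)), IsPartition Es E ∧
      ∀ n, pairDiam (Es n) < lam * pairGap (pairRect (Es n))

/-- A good-λ-embedding into `c₀`. -/
def GoodEmbedding {M : Type*} [MetricSpace M] (lam : ℝ) (f : M → C₀(ℕ, ℝ)) : Prop :=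
  (∀ n : ℕ, ∃ K : ℝ, K < lam ∧ ∀ x y : M, |f x n - f y n| ≤ K * dist x y) ∧
    ∀ x y : M, dist x y ≤ ‖f x - f y‖

/-- A strict-λ-embedding into `c₀`. -/
def StrictEmbedding {M : Type*} [MetricSpace M] (lam : ℝ) (f : M → C₀(ℕ, ℝ)) : Prop :=
  ∀ x y : M, x ≠ y → dist x y < ‖f x - f y‖ ∧ ‖f x - f y‖ < lam * dist x y

/-- A λ-embedding into `c₀`. -/
def LambdaEmbedding {M : Type*} [MetricSpace M] (lam : ℝ) (f : M → C₀(ℕ, ℝ)) : Prop :=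
  ∀ x y : M, dist x y ≤ ‖f x - f y‖ ∧ ‖f x - f y‖ ≤ lam * dist x y

/-- The gap between two subsets of `M`: `δ(U,V) = inf {d(u,v) : u ∈ U, v ∈ V}`. -/
noncomputable def setGap {M : Type*} [MetricSpace M] (U V : Set M) : ℝ :=
  sInf ((fun p : M × M => dist p.1 p.2) '' (U ×ˢ V))

/-- A positive lower bound for the norm of an element of `c₀` is reached by some coordinate. -/
theorem exists_le_abs_apply_of_le_norm (g : C₀(ℕ, ℝ)) {d : ℝ} (hd : 0 < d) (hg : d ≤ ‖g‖) :
    ∃ n, d ≤ |g n| := by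
  by_contra! hlt
  have htend : Filter.Tendsto g Filter.atTop (nhds 0) := by
    have := zero_at_infty g
    rwa [Filter.cocompact_eq_cofinite, Nat.cofinite_eq_atTop] at this
  obtain ⟨N, hN⟩ := Metric.tendsto_atTop.1 htend (d / 2) (by positivity)
  let S : Finset ℝ := insert (d / 2) ((Finset.range N).image fun n => |g n|)
  have hS : S.Nonempty := Finset.insert_nonempty _ _
  have hmax : S.max' hS < d := by
    rw [Finset.max'_lt_iff]
    intro y hy
    rcases Finset.mem_insert.1 hy with rfl | hy
    · linarith
    · obtain ⟨n, -, rfl⟩ := Finset.mem_image.1 hy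
      exact hlt n
  have hhalf : d / 2 ≤ S.max' hS := S.le_max' _ (Finset.mem_insert_self _ _)
  have hnorm : ‖g‖ ≤ S.max' hS := by
    rw [← ZeroAtInftyContinuousMap.norm_toBCF_eq_norm,
      BoundedContinuousFunction.norm_le (by linarith)]
    intro n
    change |g n| ≤ _
    by_cases hn : n < N
    · exact S.le_max' _ (Finset.mem_insert_of_mem
        (Finset.mem_image_of_mem _ (Finset.mem_range.2 hn)))
    · have := hN n (not_lt.1 hn)
      rw [Real.dist_eq, sub_zero] at this
      linarith
  linarith

/-- A colouring with finitely many colours on `E` partitions `E` into monochromatic pieces. -/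
theorem exists_isPartition_of_finite_image {α β : Type*} (g : α → β) (E : Set α)
    (hfin : (g '' E).Finite) :
    ∃ (N : ℕ) (Es : Fin N → Set α), IsPartition Es E ∧
      ∀ n, ∀ p ∈ Es n, ∀ q ∈ Es n, g p = g q := by
  have := hfin.to_subtype
  let e := (Finite.equivFin (g '' E)).symm
  refine ⟨_, fun i => {p ∈ E | g p = e i}, ⟨fun i => ?_, ?_, fun i j hij => ?_⟩, ?_⟩
  · obtain ⟨p, hp, hpe⟩ := (e i).2
    exact ⟨p, hp, hpe⟩
  · ext p
    simp only [mem_iUnion, mem_ofPred_eq]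
    refine ⟨fun ⟨_, hp, _⟩ => hp, fun hp => ⟨e.symm ⟨g p, mem_image_of_mem g hp⟩, hp, ?_⟩⟩
    rw [Equiv.apply_symm_apply]
  · rw [Set.disjoint_left]
    rintro p ⟨-, hi⟩ ⟨-, hj⟩
    exact hij (e.injective (Subtype.ext (hi.symm.trans hj)))
  · rintro n p ⟨-, hp⟩ q ⟨-, hq⟩
    exact hp.trans hq.symm

theorem pairGap_le_dist {M : Type*} [MetricSpace M] {E : Set (M × M)} {p : M × M} (hp : p ∈ E) :
    pairGap E ≤ dist p.1 p.2 :=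
  csInf_le ⟨0, by rintro _ ⟨q, -, rfl⟩; exact dist_nonneg⟩ (mem_image_of_mem _ hp)

/-- A real function with Lipschitz constant `K` oscillating by at most `ε` on each projection of
`E`, and separating the members of each pair of `E` by at least their distance, bounds the diameter
of `E` by the gap of its rectangle. -/
theorem pairDiam_le_of_oscillation_le {M : Type*} [MetricSpace M] {E : Set (M × M)}
    (hE : E.Nonempty) {u : M → ℝ} {K ε : ℝ} (hK : 0 < K)
    (hu : ∀ x y, |u x - u y| ≤ K * dist x y)
    (hsep : ∀ p ∈ E, dist p.1 p.2 ≤ |u p.1 - u p.2|)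
    (hosc : ∀ p ∈ E, ∀ q ∈ E, |u p.1 - u q.1| ≤ ε ∧ |u p.2 - u q.2| ≤ ε) :
    (∀ p ∈ E, dist p.1 p.2 ≤ pairDiam E) ∧
      pairDiam E ≤ K * pairGap (pairRect E) + 2 * ε := by
  have key : ∀ p ∈ E, dist p.1 p.2 ≤ K * pairGap (pairRect E) + 2 * ε := by
    intro p hp
    have hle : (dist p.1 p.2 - 2 * ε) / K ≤ pairGap (pairRect E) := by
      refine le_csInf (((hE.image _).prod (hE.image _)).image _) ?_
      rintro _ ⟨⟨_, _⟩, ⟨⟨a, ha, rfl⟩, b, hb, rfl⟩, rfl⟩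
      rw [div_le_iff₀' hK]
      have h₁ := hu a.1 b.2
      have h₂ := (hosc p hp a ha).1
      have h₃ := (hosc b hb p hp).2
      have h₄ := hsep p hp
      have h₅ := abs_add_three (u p.1 - u a.1) (u a.1 - u b.2) (u b.2 - u p.2)
      rw [show u p.1 - u a.1 + (u a.1 - u b.2) + (u b.2 - u p.2) = u p.1 - u p.2 by ring] at h₅
      dsimp only
      linarith
    rw [div_le_iff₀' hK] at hle
    linarith
  refine ⟨fun p hp => le_csSup ⟨K * pairGap (pairRect E) + 2 * ε, ?_⟩
    (mem_image_of_mem _ hp), csSup_le (hE.image _) ?_⟩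
  · rintro _ ⟨q, hq, rfl⟩
    exact key q hq
  · rintro _ ⟨q, hq, rfl⟩
    exact key q hq

theorem abs_sub_le_of_floor_div_eq {a b ε : ℝ} (hε : 0 < ε) (h : ⌊a / ε⌋ = ⌊b / ε⌋) :
    |a - b| ≤ ε := by
  have := Int.abs_sub_lt_one_of_floor_eq_floor h
  rw [← sub_div, abs_div, abs_of_pos hε, div_lt_one hε] at this
  exact this.le

theorem floor_div_mem_Icc {a c R ε : ℝ} (hε : 0 < ε) (h : |a - c| ≤ R) :
    ⌊a / ε⌋ ∈ Icc ⌊(c - R) / ε⌋ ⌊(c + R) / ε⌋ := by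
  rw [abs_le] at h
  constructor <;> apply Int.floor_le_floor <;> gcongr <;> linarith

/-- If there exists a good-λ-embedding from `M` into `c₀` (λ > 1), then `M` has property π(λ). -/
theorem stmt2 {M : Type*} [MetricSpace M] (lam : ℝ) (hlam : 1 < lam)
    (h : ∃ f : M → C₀(ℕ, ℝ), GoodEmbedding lam f) :
    PropertyPi M lam := by
  obtain ⟨f, hlip, hnorm⟩ := h
  intro a₁ a₂ r₁ r₂ E hE hsub hgap
  obtain ⟨p₀, hp₀⟩ := hE
  have hr₁ : 0 ≤ r₁ := dist_nonneg.trans (mem_closedBall.1 (hsub hp₀).1)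
  have hr₂ : 0 ≤ r₂ := dist_nonneg.trans (mem_closedBall.1 (hsub hp₀).2)
  set δ := pairGap E with hδdef
  have hδ : 0 < δ := lt_of_le_of_lt (by positivity) hgap
  have hK : ∀ n, ∃ K : ℝ, 0 < K ∧ K < lam ∧ ∀ x y, |f x n - f y n| ≤ K * dist x y := by
    intro n
    obtain ⟨K, hK, hKf⟩ := hlip n
    refine ⟨max K 1, by positivity, max_lt hK hlam, fun x y => (hKf x y).trans ?_⟩
    gcongr
    exact le_max_left _ _
  choose K hKpos hKlam hKf using hK
  have hball : ∀ n x a r, dist x a ≤ r → |f x n - f a n| ≤ lam * r := fun n x a r hx =>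
    (hKf n x a).trans (mul_le_mul (hKlam n).le hx dist_nonneg (by linarith))
  have htend : Filter.Tendsto (f a₁ - f a₂) Filter.atTop (nhds 0) := by
    have := zero_at_infty (f a₁ - f a₂)
    rwa [Filter.cocompact_eq_cofinite, Nat.cofinite_eq_atTop] at this
  obtain ⟨N, hN⟩ := Metric.tendsto_atTop.1 htend (δ - lam * (r₁ + r₂)) (by linarith)
  have hcoord : ∀ p ∈ E, ∃ n < N, dist p.1 p.2 ≤ |f p.1 n - f p.2 n| := by
    intro p hp
    have hδp : δ ≤ dist p.1 p.2 := pairGap_le_dist hp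
    obtain ⟨n, hn⟩ := exists_le_abs_apply_of_le_norm _ (hδ.trans_le hδp) (hnorm p.1 p.2)
    rw [ZeroAtInftyContinuousMap.sub_apply] at hn
    refine ⟨n, not_le.1 fun hNn => ?_, hn⟩
    have h₁ := hball n p.1 a₁ r₁ (hsub hp).1
    have h₂ := hball n p.2 a₂ r₂ (hsub hp).2
    have h₃ := hN n hNn
    rw [Real.dist_eq, sub_zero, ZeroAtInftyContinuousMap.sub_apply] at h₃
    have h₄ := abs_add_three (f p.1 n - f a₁ n) (f a₁ n - f a₂ n) (f a₂ n - f p.2 n)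
    rw [show f p.1 n - f a₁ n + (f a₁ n - f a₂ n) + (f a₂ n - f p.2 n) = f p.1 n - f p.2 n by ring,
      abs_sub_comm (f a₂ n)] at h₄
    linarith
  choose! ν hνN hν using hcoord
  let ε : ℕ → ℝ := fun n => δ * (lam - K n) / (4 * lam)
  have hε : ∀ n, 0 < ε n := fun n =>
    div_pos (mul_pos hδ (sub_pos.2 (hKlam n))) (by linarith)
  let g : M × M → ℕ × ℤ × ℤ := fun p =>
    (ν p, ⌊f p.1 (ν p) / ε (ν p)⌋, ⌊f p.2 (ν p) / ε (ν p)⌋)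
  have hfin : (g '' E).Finite := by
    refine Set.Finite.subset ((Set.finite_lt_nat N).biUnion fun n _ =>
      (Set.finite_singleton n).prod
        ((Set.finite_Icc ⌊(f a₁ n - lam * r₁) / ε n⌋ ⌊(f a₁ n + lam * r₁) / ε n⌋).prod
          (Set.finite_Icc ⌊(f a₂ n - lam * r₂) / ε n⌋ ⌊(f a₂ n + lam * r₂) / ε n⌋))) ?_
    rintro _ ⟨p, hp, rfl⟩
    exact mem_biUnion (hνN p hp) ⟨rfl,
      floor_div_mem_Icc (hε _) (hball _ _ _ _ (hsub hp).1),
      floor_div_mem_Icc (hε _) (hball _ _ _ _ (hsub hp).2)⟩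
  obtain ⟨m, Es, hpart, hcol⟩ := exists_isPartition_of_finite_image g E hfin
  refine ⟨m, Es, hpart, fun i => ?_⟩
  have hEs : Es i ⊆ E := hpart.2.1 ▸ subset_iUnion Es i
  obtain ⟨p, hp⟩ := hpart.1 i
  have hνp : ∀ q ∈ Es i, ν q = ν p := fun q hq => congrArg Prod.fst (hcol i q hq p hp)
  obtain ⟨hle, hdiam⟩ := pairDiam_le_of_oscillation_le (E := Es i) (u := fun x => f x (ν p))
    (ε := ε (ν p)) ⟨p, hp⟩ (hKpos (ν p)) (hKf (ν p))
    (fun q hq => hνp q hq ▸ hν q (hEs hq)) (fun q hq q' hq' => by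
      have h := hcol i q hq q' hq'
      simp only [g, hνp q hq, hνp q' hq', Prod.mk.injEq, true_and] at h
      exact ⟨abs_sub_le_of_floor_div_eq (hε _) h.1, abs_sub_le_of_floor_div_eq (hε _) h.2⟩)
  have hδD : δ ≤ pairDiam (Es i) := (pairGap_le_dist (hEs hp)).trans (hle p hp)
  have hεeq : 4 * lam * ε (ν p) = δ * (lam - K (ν p)) :=
    mul_div_cancel₀ _ (by linarith)
  have hmul := mul_le_mul_of_nonneg_right hδD (sub_pos.2 (hKlam (ν p))).le
  have hpos := mul_pos hδ (sub_pos.2 (hKlam (ν p)))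
  have hlamD := mul_le_mul_of_nonneg_left hdiam (by linarith : (0 : ℝ) ≤ lam)
  refine lt_of_mul_lt_mul_left ?_ (hKpos (ν p)).le
  nlinarith
end

section
/- Let X be a real Banach space and λ ≥ 1. Suppose there exist u ∈ X with ‖u‖ = 1 and an infinite-dimensional closed subspace Y of X such that inf{‖u + y‖ : y ∈ Y, ‖y‖ = 1} > λ. Then there is no λ-embedding from X into c₀. -/
open Metric Set ZeroAtInfty

open Filter Topology Polynomial

/-- The sequence with first term `a` followed by the terms of `s`. -/
def consSeq (a : ℕ) (s : ℕ → ℕ) : ℕ → ℕ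
  | 0 => a
  | n + 1 => s n

/-- The increasing map `ℕ → ℕ` whose range omits exactly `j`. -/
def skip (j n : ℕ) : ℕ := if n < j then n else n + 1

/-- Iterated product of the hyperfilter on `ℕ`, seen as an ultrafilter on sequences
vanishing from index `m` on. -/
noncomputable def iterUltra : ℕ → Ultrafilter (ℕ → ℕ)
  | 0 => pure 0
  | m + 1 => (hyperfilter ℕ).bind fun a => (iterUltra m).map (consSeq a)

/-- The limit of the iterated ultrafilters `iterUltra m` as `m → ∞`. -/
noncomputable def iterFilter : Filter (ℕ → ℕ) :=
  Filter.bind atTop fun m => (iterUltra m : Filter (ℕ → ℕ))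

lemma coe_iterUltra_succ (m : ℕ) : (iterUltra (m + 1) : Filter (ℕ → ℕ)) =
    Filter.bind (hyperfilter ℕ) fun a => Filter.map (consSeq a) (iterUltra m) := rfl

lemma consSeq_comp_skip_zero (a : ℕ) (s : ℕ → ℕ) : consSeq a s ∘ skip 0 = s := by
  ext n
  simp [skip, consSeq]

lemma consSeq_comp_skip_succ (a j : ℕ) (s : ℕ → ℕ) :
    consSeq a s ∘ skip (j + 1) = consSeq a (s ∘ skip j) := by
  ext n
  cases n with
  | zero => simp [skip, consSeq]
  | succ n =>
    by_cases h : n < j <;> simp [skip, consSeq, h]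

lemma map_skip_zero_iterUltra (m : ℕ) :
    Filter.map (· ∘ skip 0) (iterUltra (m + 1) : Filter (ℕ → ℕ)) = iterUltra m := by
  have h : ∀ a, (· ∘ skip 0) ∘ consSeq a = id := fun a => funext (consSeq_comp_skip_zero a)
  ext S
  rw [coe_iterUltra_succ, Filter.map_bind, Filter.mem_bind']
  simp only [Function.comp_apply, Filter.map_map, h, Filter.map_id]
  exact eventually_const

lemma map_skip_iterUltra {m j : ℕ} (hj : j ≤ m) :
    Filter.map (· ∘ skip j) (iterUltra (m + 1) : Filter (ℕ → ℕ)) = iterUltra m := by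
  induction m generalizing j with
  | zero =>
    obtain rfl : j = 0 := by omega
    exact map_skip_zero_iterUltra 0
  | succ m ih =>
    cases j with
    | zero => exact map_skip_zero_iterUltra (m + 1)
    | succ j =>
      rw [coe_iterUltra_succ, Filter.map_bind]
      conv_rhs => rw [coe_iterUltra_succ]
      congr 1
      ext1 a
      rw [Function.comp_apply, Filter.map_map, ← ih (j := j) (by omega), Filter.map_map]
      congr 1
      ext1 s
      exact consSeq_comp_skip_succ a j s

instance iterFilter_neBot : iterFilter.NeBot := by
  refine ⟨fun h => ?_⟩
  have h0 : ∀ᶠ _ in iterFilter, False := by simp [h]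
  rw [iterFilter, Filter.eventually_bind] at h0
  obtain ⟨m, hm⟩ := h0.exists
  exact hm.exists.elim fun _ h => h

lemma tendsto_skip_iterFilter (j : ℕ) : Tendsto (· ∘ skip j) iterFilter iterFilter := by
  intro S hS
  change ∀ᶠ s in iterFilter, s ∘ skip j ∈ S
  have hS' : ∀ᶠ s in iterFilter, s ∈ S := hS
  rw [iterFilter, Filter.eventually_bind, eventually_atTop] at hS' ⊢
  obtain ⟨m, hm⟩ := hS'
  refine ⟨max m j + 1, fun n hn => ?_⟩
  obtain ⟨k, rfl⟩ : ∃ k, n = k + 1 := ⟨n - 1, by omega⟩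
  have := hm k (by omega)
  rw [← map_skip_iterUltra (show j ≤ k by omega), eventually_map] at this
  exact this

lemma eventually_ne_succ (i : ℕ) : ∀ᶠ s in iterFilter, s i ≠ s (i + 1) := by
  induction i with
  | zero =>
    rw [iterFilter, Filter.eventually_bind, eventually_atTop]
    refine ⟨2, fun n hn => ?_⟩
    obtain ⟨k, rfl⟩ : ∃ k, n = k + 1 + 1 := ⟨n - 2, by omega⟩
    rw [coe_iterUltra_succ, Filter.eventually_bind]
    refine Eventually.of_forall fun a => ?_
    rw [eventually_map, coe_iterUltra_succ, Filter.eventually_bind]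
    have : ∀ᶠ b in (hyperfilter ℕ : Filter ℕ), b ≠ a :=
      hyperfilter_le_cofinite (Set.finite_singleton a).compl_mem_cofinite
    filter_upwards [this] with b hb
    rw [eventually_map]
    exact Eventually.of_forall fun s => by simpa [consSeq] using hb.symm
  | succ i ih => simpa [skip] using (tendsto_skip_iterFilter 0).eventually ih

section Combination

variable {E : Type*} [NormedAddCommGroup E] [NormedSpace ℝ E]

/-- The linear combination of the subsequence `e ∘ s` with the coefficients of a polynomial. -/
noncomputable def seqComb (e : ℕ → E) (s : ℕ → ℕ) : ℝ[X] →ₗ[ℝ] E :=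
  (Polynomial.basisMonomials ℝ).constr ℝ (e ∘ s)

lemma seqComb_monomial (e : ℕ → E) (s : ℕ → ℕ) (n : ℕ) (r : ℝ) :
    seqComb e s (monomial n r) = r • e (s n) := by
  have h : seqComb e s (monomial n 1) = e (s n) := by
    simpa [seqComb] using (Polynomial.basisMonomials ℝ).constr_basis ℝ (e ∘ s) n
  rw [← h, ← map_smul, smul_monomial, smul_eq_mul, mul_one]

lemma seqComb_eq_sum (e : ℕ → E) (s : ℕ → ℕ) (p : ℝ[X]) :
    seqComb e s p = ∑ i ∈ Finset.range (p.natDegree + 1), p.coeff i • e (s i) := by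
  conv_lhs => rw [p.as_sum_range, map_sum]
  simp only [seqComb_monomial]

lemma seqComb_X_mul (e : ℕ → E) (s : ℕ → ℕ) (p : ℝ[X]) :
    seqComb e s (X * p) = seqComb e (s ∘ skip 0) p := by
  induction p using Polynomial.induction_on' with
  | add p q hp hq => rw [mul_add, map_add, map_add, hp, hq]
  | monomial n r => simp [X_mul_monomial, seqComb_monomial, skip]

lemma seqComb_skip_sub (e : ℕ → E) (s : ℕ → ℕ) (i : ℕ) (p : ℝ[X]) :
    seqComb e (s ∘ skip (i + 1)) p - seqComb e (s ∘ skip i) p =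
      p.coeff i • (e (s i) - e (s (i + 1))) := by
  induction p using Polynomial.induction_on' with
  | add p q hp hq =>
    rw [coeff_add, add_smul, ← hp, ← hq, map_add, map_add]
    abel
  | monomial n r =>
    rw [seqComb_monomial, seqComb_monomial, coeff_monomial]
    rcases lt_trichotomy n i with h | rfl | h
    · simp [skip, h, h.ne, h.trans (Nat.lt_succ_self i)]
    · simp [skip, smul_sub]
    · simp [skip, h.ne', h.not_gt, show ¬ n < i + 1 by omega]

lemma tendsto_seqComb (e : ℕ → E) (p : ℝ[X]) :
    ∃ W : Ultrafilter E, Tendsto (fun s => seqComb e s p) iterFilter W := by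
  have key : ∀ m, p.natDegree + 1 ≤ m →
      Filter.map (fun s => seqComb e s p) (iterUltra m) =
        Filter.map (fun s => seqComb e s p) (iterUltra (p.natDegree + 1)) := by
    intro m hm
    induction m, hm using Nat.le_induction with
    | base => rfl
    | succ m hm ih =>
      rw [← ih, ← map_skip_iterUltra (le_refl m), Filter.map_map]
      congr 1
      ext1 s
      rw [Function.comp_apply, seqComb_eq_sum, seqComb_eq_sum]
      refine Finset.sum_congr rfl fun i hi => ?_
      have : i < m := (Finset.mem_range.1 hi).trans_le hm
      simp [skip, this]
  refine ⟨(iterUltra (p.natDegree + 1)).map fun s => seqComb e s p, fun S hS => ?_⟩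
  change ∀ᶠ s in iterFilter, seqComb e s p ∈ S
  rw [iterFilter, Filter.eventually_bind, eventually_atTop]
  refine ⟨p.natDegree + 1, fun m hm => ?_⟩
  rw [Ultrafilter.coe_map, ← key m hm] at hS
  exact hS

lemma exists_tendsto_norm_seqComb {e : ℕ → E} {R : ℝ} (hR : ∀ n, ‖e n‖ ≤ R) (p : ℝ[X]) :
    ∃ l : ℝ, Tendsto (fun s => ‖seqComb e s p‖) iterFilter (𝓝 l) := by
  obtain ⟨W, hW⟩ := tendsto_seqComb e p
  set C := ∑ i ∈ Finset.range (p.natDegree + 1), ‖p.coeff i‖ * R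
  have hC : ∀ s, ‖seqComb e s p‖ ≤ C := fun s => by
    rw [seqComb_eq_sum]
    refine norm_sum_le_of_le _ fun i _ => ?_
    rw [norm_smul]
    exact mul_le_mul_of_nonneg_left (hR _) (norm_nonneg _)
  have hmem : ∀ᶠ x in (W : Filter E), ‖x‖ ∈ Set.Icc 0 C := by
    by_contra h
    rw [← Ultrafilter.eventually_not] at h
    obtain ⟨s, hs⟩ := (hW.eventually h).exists
    exact hs ⟨norm_nonneg _, hC s⟩
  obtain ⟨l, -, hl⟩ := isCompact_Icc.ultrafilter_le_nhds (W.map norm)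
    (le_principal_iff.2 hmem)
  exact ⟨l, (show Tendsto norm (W : Filter E) (𝓝 l) from hl).comp hW⟩

/-- In the spreading model of a separated bounded sequence, `-1` is an approximate eigenvalue
of the shift. -/
lemma exists_approx_eigenvector {e : ℕ → E} {R : ℝ} (hR : ∀ n, ‖e n‖ ≤ R)
    (he : Pairwise fun m n => 1 ≤ ‖e m - e n‖) {δ : ℝ} (hδ : 0 < δ) :
    ∃ (p : ℝ[X]) (a b : ℝ), 0 < a ∧ b < δ * a ∧
      Tendsto (fun s => ‖seqComb e s p‖) iterFilter (𝓝 a) ∧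
      Tendsto (fun s => ‖seqComb e s ((1 + X) * p)‖) iterFilter (𝓝 b) := by
  choose ν hν using exists_tendsto_norm_seqComb hR
  have hν0 : ∀ p, 0 ≤ ν p := fun p => ge_of_tendsto' (hν p) fun s => norm_nonneg _
  by_contra! hcon
  have hlow : ∀ p, δ * ν p ≤ ν ((1 + X) * p) := fun p => by
    by_contra! hlt
    have hpos : 0 < ν p := by
      by_contra! h0
      nlinarith [hν0 ((1 + X) * p)]
    exact hcon p _ _ hpos hlt (hν p) (hν _)
  have hsub : ∀ p q, ν (p - q) ≤ ν p + ν q := fun p q =>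
    le_of_tendsto_of_tendsto' (hν _) ((hν p).add (hν q)) fun s => by
      rw [map_sub]; exact norm_sub_le _ _
  have hX : ∀ p, ν (-X * p) = ν p := fun p => by
    refine tendsto_nhds_unique (hν _) ?_
    simpa [Function.comp_def, neg_mul, seqComb_X_mul] using
      (hν p).comp (tendsto_skip_iterFilter 0)
  have hXpow : ∀ k p, ν ((-X) ^ k * p) = ν p := fun k p => by
    induction k with
    | zero => simp
    | succ k ih => rw [pow_succ', mul_assoc, hX, ih]
  have hcoeff : ∀ p i, |p.coeff i| ≤ 2 * ν p := fun p i => by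
    have h1 := (hν p).comp (tendsto_skip_iterFilter (i + 1))
    have h2 := (hν p).comp (tendsto_skip_iterFilter i)
    rw [two_mul]
    refine ge_of_tendsto (h1.add h2) ?_
    filter_upwards [eventually_ne_succ i] with s hs
    calc |p.coeff i| ≤ |p.coeff i| * ‖e (s i) - e (s (i + 1))‖ :=
          le_mul_of_one_le_right (abs_nonneg _) (he hs)
      _ = ‖seqComb e (s ∘ skip (i + 1)) p - seqComb e (s ∘ skip i) p‖ := by
          rw [seqComb_skip_sub, norm_smul, Real.norm_eq_abs]
      _ ≤ _ := norm_sub_le _ _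
  set q : ℕ → ℝ[X] := fun k => ∑ i ∈ Finset.range k, (-X) ^ i with hq
  have hgeom : ∀ k p, δ * ν (q k * p) ≤ 2 * ν p := fun k p => by
    have h := hlow (q k * p)
    rw [← mul_assoc, show (1 + X : ℝ[X]) = 1 - -X by ring, hq, mul_neg_geom_sum, sub_mul,
      one_mul] at h
    linarith [hsub p ((-X) ^ k * p), hXpow k p]
  have hqcoeff : ∀ k i, i < k → (q k).coeff i = (-1) ^ i := fun k i hi => by
    have : ∀ j, ((-X : ℝ[X]) ^ j).coeff i = if i = j then (-1) ^ j else 0 := fun j => by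
      rw [neg_pow, show (-1 : ℝ[X]) ^ j = C ((-1) ^ j) by simp, coeff_C_mul, coeff_X_pow]
      simp
    simp [hq, finsetSum_coeff, this, hi]
  have hsq : ∀ k, (q (k + 1) * (q (k + 1) * 1)).coeff k = (k + 1) * (-1) ^ k := fun k => by
    rw [mul_one, coeff_mul, Finset.sum_congr rfl (g := fun _ => (-1) ^ k)]
    · simp
    · intro x hx
      have hx' := Finset.HasAntidiagonal.mem_antidiagonal.1 hx
      rw [hqcoeff _ _ (by omega), hqcoeff _ _ (by omega), ← pow_add, hx']
  obtain ⟨k, hk⟩ := exists_nat_gt (8 * ν 1 / δ ^ 2)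
  have h1 := hcoeff (q (k + 1) * (q (k + 1) * 1)) k
  rw [hsq, abs_mul, abs_pow, abs_neg, abs_one, one_pow, mul_one,
    abs_of_nonneg (by positivity)] at h1
  have h2 := hgeom (k + 1) (q (k + 1) * 1)
  have h3 := hgeom (k + 1) 1
  rw [div_lt_iff₀ (by positivity)] at hk
  nlinarith [mul_le_mul_of_nonneg_left h2 hδ.le, mul_le_mul_of_nonneg_left h1 (sq_nonneg δ),
    sq_nonneg δ]

/-- An approximate Lyusternik–Schnirelmann theorem on infinite-dimensional unit spheres. -/
lemma exists_almost_antipodal {κ : Type*} [Finite κ] (hE : ¬ FiniteDimensional ℝ E)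
    (col : E → κ) {δ : ℝ} (hδ : 0 < δ) :
    ∃ y z : E, ‖y‖ = 1 ∧ ‖z‖ = 1 ∧ ‖y + z‖ < δ ∧ col y = col z := by
  obtain ⟨R, e, -, hR, he⟩ := exists_seq_norm_le_one_le_norm_sub hE
  obtain ⟨p, a, b, ha, hb, hpa, hpb⟩ := exists_approx_eigenvector hR he hδ
  obtain ⟨W, hW⟩ := tendsto_seqComb e p
  obtain ⟨c, hc⟩ : ∃ c, ∀ᶠ x in (W : Filter E), col (‖x‖⁻¹ • x) = c :=
    Ultrafilter.eventually_exists_iff.1 (Eventually.of_forall fun x => ⟨_, rfl⟩)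
  have hskip := tendsto_skip_iterFilter 0
  have hc1 := hW.eventually hc
  have hpa' := hpa.comp hskip
  have hlim : Tendsto (fun s => ‖seqComb e s p‖⁻¹ * ‖seqComb e s ((1 + X) * p)‖ +
      |‖seqComb e (s ∘ skip 0) p‖⁻¹ - ‖seqComb e s p‖⁻¹| * ‖seqComb e (s ∘ skip 0) p‖)
      iterFilter (𝓝 (a⁻¹ * b + |a⁻¹ - a⁻¹| * a)) :=
    ((hpa.inv₀ ha.ne').mul hpb).add
      (((hpa'.inv₀ ha.ne').sub (hpa.inv₀ ha.ne')).abs.mul hpa')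
  have hlt : a⁻¹ * b + |a⁻¹ - a⁻¹| * a < δ := by
    rw [sub_self, abs_zero, zero_mul, add_zero, inv_mul_lt_iff₀ ha, mul_comm]
    exact hb
  obtain ⟨s, h1, h2, h3, h4, h5⟩ := (hc1.and <| (hskip.eventually hc1).and <|
    (hpa.eventually_const_lt ha).and <| (hpa'.eventually_const_lt ha).and <|
    hlim.eventually_lt_const hlt).exists
  simp only [Function.comp_apply] at h4
  set x := seqComb e s p
  set x' := seqComb e (s ∘ skip 0) p
  have hsum : seqComb e s ((1 + X) * p) = x + x' := by
    rw [add_mul, one_mul, map_add, seqComb_X_mul]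
  refine ⟨‖x‖⁻¹ • x, ‖x'‖⁻¹ • x', ?_, ?_, ?_, h1.trans h2.symm⟩
  · rw [norm_smul, norm_inv, norm_norm, inv_mul_cancel₀ h3.ne']
  · rw [norm_smul, norm_inv, norm_norm, inv_mul_cancel₀ h4.ne']
  · refine lt_of_le_of_lt ?_ h5
    rw [hsum]
    calc ‖‖x‖⁻¹ • x + ‖x'‖⁻¹ • x'‖
        = ‖‖x‖⁻¹ • (x + x') + (‖x'‖⁻¹ - ‖x‖⁻¹) • x'‖ := by
          rw [smul_add, sub_smul]; congr 1; abel
      _ ≤ _ := by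
          refine (norm_add_le _ _).trans_eq ?_
          rw [norm_smul, norm_smul, norm_inv, norm_norm, Real.norm_eq_abs]

end Combination

lemma exists_lt_abs_apply_of_lt_norm {h : C₀(ℕ, ℝ)} {t : ℝ} (ht0 : 0 ≤ t) (ht : t < ‖h‖) :
    ∃ n, t < |h n| := by
  by_contra! hle
  rw [← ZeroAtInftyContinuousMap.norm_toBCF_eq_norm] at ht
  exact ht.not_ge ((BoundedContinuousFunction.norm_le ht0).2 hle)

lemma abs_apply_le_norm (h : C₀(ℕ, ℝ)) (n : ℕ) : |h n| ≤ ‖h‖ := by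
  rw [← ZeroAtInftyContinuousMap.norm_toBCF_eq_norm]
  exact h.toBCF.norm_coe_le_norm n

/-- If `X` is a Banach space, `u ∈ S_X`, and `Y` is an infinite-dimensional closed subspace with
`inf {‖u + y‖ : y ∈ S_Y} > λ`, then there is no λ-embedding from `X` into `c₀`. -/
theorem stmt4 {X : Type*} [NormedAddCommGroup X] [NormedSpace ℝ X] [CompleteSpace X]
    (lam : ℝ) (hlam : 1 ≤ lam) (u : X) (hu : ‖u‖ = 1)
    (Y : Subspace ℝ X) (hYclosed : IsClosed (Y : Set X)) (hYinf : ¬ FiniteDimensional ℝ Y)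
    (hgap : lam < sInf {r : ℝ | ∃ y ∈ Y, ‖y‖ = 1 ∧ r = ‖u + y‖}) :
    ¬ ∃ f : X → C₀(ℕ, ℝ), LambdaEmbedding lam f := by
  rintro ⟨f, hf⟩
  have hdist : ∀ (n : ℕ) (x y : X), |f x n - f y n| ≤ lam * ‖x - y‖ := fun n x y => by
    rw [← dist_eq_norm]
    exact (abs_apply_le_norm (f x - f y) n).trans (hf x y).2
  set μ := sInf {r : ℝ | ∃ y ∈ Y, ‖y‖ = 1 ∧ r = ‖u + y‖}
  have hμ : ∀ y ∈ Y, ‖y‖ = 1 → μ ≤ ‖u + y‖ := fun y hy hy1 =>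
    csInf_le ⟨0, by rintro _ ⟨_, -, -, rfl⟩; exact norm_nonneg _⟩ ⟨y, hy, hy1, rfl⟩
  obtain ⟨τ, hlτ, hτμ⟩ := exists_between hgap
  have hlarge : ∀ y ∈ Y, ‖y‖ = 1 → ∃ n, 2 * τ < |f (u + y) n - f (-(u + y)) n| := by
    intro y hy hy1
    refine exists_lt_abs_apply_of_lt_norm (h := f (u + y) - f (-(u + y))) (by linarith) ?_
    have h := (hf (u + y) (-(u + y))).1
    rw [dist_eq_norm, sub_neg_eq_add, ← two_smul ℝ, norm_smul, Real.norm_two] at h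
    linarith [hμ y hy hy1]
  obtain ⟨N, hN⟩ : ∃ N : ℕ, ∀ n ≥ N, |f u n - f (-u) n| < 2 * (τ - lam) := by
    have h := (f u - f (-u)).zero_at_infty'
    rw [Filter.cocompact_eq_cofinite, Nat.cofinite_eq_atTop] at h
    have h' := h.abs
    rw [abs_zero] at h'
    exact eventually_atTop.1 (h'.eventually_lt_const (by linarith))
  have hsmall : ∀ y ∈ Y, ‖y‖ = 1 → ∀ n, 2 * τ < |f (u + y) n - f (-(u + y)) n| → n < N := by
    intro y hy hy1 n hn
    by_contra! hNn
    have h1 := hdist n (u + y) u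
    have h2 := hdist n (-u) (-(u + y))
    rw [add_sub_cancel_left, hy1] at h1
    rw [show -u - -(u + y) = y by abel, hy1] at h2
    have h3 := hN n hNn
    have h4 := abs_add_three (f (u + y) n - f u n) (f u n - f (-u) n)
      (f (-u) n - f (-(u + y)) n)
    rw [show f (u + y) n - f u n + (f u n - f (-u) n) + (f (-u) n - f (-(u + y)) n) =
      f (u + y) n - f (-(u + y)) n by ring] at h4
    linarith
  have hcol : ∀ y : Y, ∃ c : Fin (N + 1) × Bool, ‖y‖ = 1 →
      2 * τ < (if c.2 then 1 else -1) * (f (u + y) c.1 - f (-(u + y)) c.1) := by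
    intro y
    by_cases hy1 : ‖y‖ = 1
    · obtain ⟨n, hn⟩ := hlarge y y.2 hy1
      have hnN := hsmall y y.2 hy1 n hn
      rcases lt_abs.1 hn with h | h
      · exact ⟨(⟨n, by omega⟩, true), fun _ => by simpa using h⟩
      · exact ⟨(⟨n, by omega⟩, false), fun _ => by simpa using h⟩
    · exact ⟨(0, true), fun h => absurd h hy1⟩
  choose col hcol using hcol
  have hlam0 : 0 < lam := by linarith
  obtain ⟨y, z, hy, hz, hyz, hc⟩ := exists_almost_antipodal hYinf col
    (δ := 2 * (τ - lam) / lam) (div_pos (by linarith) hlam0)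
  have h1 := hcol y hy
  have h2 := hcol z hz
  rw [← hc] at h2
  set n : ℕ := (col y).1.1
  rw [lt_div_iff₀ hlam0] at hyz
  have hnorm : ‖(2 : ℝ) • u + (y + z : X)‖ ≤ 2 + ‖y + z‖ := by
    refine (norm_add_le _ _).trans_eq ?_
    rw [norm_smul, Real.norm_two, hu, mul_one]
    rfl
  have h3 := hdist n (u + y) (-(u + z))
  have h4 := hdist n (u + z) (-(u + y))
  rw [show u + y - -(u + z) = (2 : ℝ) • u + (y + z : X) by rw [two_smul]; abel] at h3
  rw [show u + z - -(u + y) = (2 : ℝ) • u + (y + z : X) by rw [two_smul]; abel] at h4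
  have h5 := mul_le_mul_of_nonneg_left hnorm hlam0.le
  rw [abs_le] at h3 h4
  split_ifs at h1 h2 <;> nlinarith
end
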